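/- arXiv:2506.03661 — 6 statements merged into one kernel-verified Lean document; each statement's English description precedes it below -/
import Mathlib

section
/- Let J ≥ 2 be an integer, let q ∈ (1, 1 + 1/(J−1)), and let λ₁, …, λ_J ∈ (0, 1) with ∑_{j=1}^J λⱼ = 1. Then there exists a function α : ℕ → {1, …, J} such that for every j ∈ {1, …, J} the preimage α⁻¹({j}) is infinite and ∑_{n ∈ α⁻¹({j})} q^{−n} = λⱼ · q/(q − 1). -/
/-- Greedy splitting: if each remaining tail of a positive series exceeds `J` times its first term,
then the series splits into `J` infinite subseries with any prescribed positive sums adding up to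
the total. -/
theorem exists_greedy_splitting {J : ℕ} (hJ : 0 < J) (a t : ℕ → ℝ) (ha : ∀ n, 0 ≤ a n)
    (ht : ∀ n, t (n + 1) = t n - a n) (hat : ∀ n, J * a n < t n)
    (ht0 : Filter.Tendsto t Filter.atTop (nhds 0))
    (s : Fin J → ℝ) (hs : ∀ j, 0 < s j) (hsum : ∑ j, s j = t 0) :
    ∃ α : ℕ → Fin J, ∀ j, (α ⁻¹' {j}).Infinite ∧ HasSum ((α ⁻¹' {j}).indicator a) (s j) := by
  have : Nonempty (Fin J) := ⟨⟨0, hJ⟩⟩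
  choose m hm using fun v : Fin J → ℝ => Finite.exists_max v
  let r : ℕ → Fin J → ℝ := fun n =>
    Nat.rec s (fun n v => v - Pi.single (m v) (a n)) n
  have hr : ∀ n, r (n + 1) = r n - Pi.single (m (r n)) (a n) := fun _ => rfl
  have hrsum : ∀ n, ∑ j, r n j = t n := by
    intro n
    induction n with
    | zero => exact hsum
    | succ n ih => simp [hr, ht, ih]
  have hmax : ∀ n, a n < r n (m (r n)) := by
    intro n
    have h : ∑ j, r n j ≤ J * r n (m (r n)) := by
      simpa using Finset.sum_le_card_nsmul Finset.univ (r n) _ fun j _ => hm (r n) j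
    rw [hrsum] at h
    exact lt_of_mul_lt_mul_left ((hat n).trans_le h) (Nat.cast_nonneg J)
  have hpos : ∀ n j, 0 < r n j := by
    intro n
    induction n with
    | zero => exact hs
    | succ n ih =>
      intro j
      rw [hr]
      by_cases hj : j = m (r n)
      · subst hj
        simpa using hmax n
      · simpa [hj] using ih j
  let α : ℕ → Fin J := fun n => m (r n)
  have hpartial : ∀ j n, ∑ i ∈ Finset.range n, (α ⁻¹' {j}).indicator a i = s j - r n j := by
    intro j n
    induction n with
    | zero => simp [r]
    | succ n ih =>
      rw [Finset.sum_range_succ, ih, hr]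
      by_cases hj : m (r n) = j
      · simp [α, Set.indicator, hj]
        ring
      · simp [α, Set.indicator, hj, Ne.symm hj]
  have hlim : ∀ j, Filter.Tendsto (fun n => r n j) Filter.atTop (nhds 0) := fun j =>
    squeeze_zero (fun n => (hpos n j).le) (fun n => by
      rw [← hrsum n]
      exact Finset.single_le_sum (fun i _ => (hpos n i).le) (Finset.mem_univ j)) ht0
  have hhas : ∀ j, HasSum ((α ⁻¹' {j}).indicator a) (s j) := by
    intro j
    rw [hasSum_iff_tendsto_nat_of_nonneg (fun i => Set.indicator_nonneg (fun n _ => ha n) i)]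
    simp only [hpartial]
    simpa using (hlim j).const_sub (s j)
  refine ⟨α, fun j => ⟨fun hfin => ?_, hhas j⟩⟩
  obtain ⟨N, hN⟩ := hfin.bddAbove
  have h : HasSum ((α ⁻¹' {j}).indicator a)
      (∑ i ∈ Finset.range (N + 1), (α ⁻¹' {j}).indicator a i) := by
    refine hasSum_sum_of_ne_finset_zero fun i hi => Set.indicator_of_notMem (fun hmem => hi ?_) _
    exact Finset.mem_range_succ_iff.2 (hN hmem)
  have heq := h.unique (hhas j)
  rw [hpartial] at heq
  linarith [hpos (N + 1) j]


/-- Geometric series separation lemma: for `J ≥ 2`, `q ∈ (1, 1 + 1/(J−1))` and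
weights `λ₁, …, λ_J ∈ (0,1)` summing to `1`, there is `α : ℕ → {1, …, J}` with
all preimages infinite such that `∑_{n ∈ α⁻¹({j})} q⁻ⁿ = λⱼ · q/(q−1)`. -/
theorem split_power_series
    (J : ℕ) (hJ : 2 ≤ J) (q : ℝ) (hq1 : 1 < q) (hq2 : q < 1 + 1 / ((J : ℝ) - 1))
    (lam : Fin J → ℝ) (hlam : ∀ j, lam j ∈ Set.Ioo (0 : ℝ) 1)
    (hsum : ∑ j, lam j = 1) :
    ∃ α : ℕ → Fin J,
      (∀ j, (α ⁻¹' {j}).Infinite) ∧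
      ∀ j, ∑' n : (α ⁻¹' {j} : Set ℕ), 1 / q ^ (n : ℕ) = lam j * (q / (q - 1)) := by
  have hq0 : 0 < q - 1 := sub_pos.2 hq1
  have hqpos : 0 < q := by linarith
  have hJ1 : (0 : ℝ) < (J : ℝ) - 1 := by
    have : (2 : ℝ) ≤ J := by exact_mod_cast hJ
    linarith
  have hJq : (J : ℝ) < q / (q - 1) := by
    rw [← sub_lt_iff_lt_add', lt_div_iff₀ hJ1] at hq2
    rw [lt_div_iff₀ hq0]
    linarith
  obtain ⟨α, hα⟩ := exists_greedy_splitting (by omega : 0 < J) (fun n => 1 / q ^ n)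
    (fun n => 1 / q ^ n * (q / (q - 1))) (fun n => by positivity)
    (fun n => by field_simp; ring)
    (fun n => by
      rw [mul_comm]
      exact mul_lt_mul_of_pos_left hJq (by positivity))
    (by
      have h := tendsto_pow_atTop_nhds_zero_of_lt_one (inv_pos.2 hqpos).le (inv_lt_one_of_one_lt₀ hq1)
      simpa using h.mul_const (q / (q - 1)))
    (fun j => lam j * (q / (q - 1)))
    (fun j => mul_pos (hlam j).1 (div_pos hqpos hq0))
    (by simp [← Finset.sum_mul, hsum])
  refine ⟨α, fun j => (hα j).1, fun j => ?_⟩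
  rw [tsum_subtype (α ⁻¹' {j}) fun n : ℕ => 1 / q ^ n]
  exact (hα j).2.tsum_eq
end

section
/- Let (X, d) be a nonempty compact metric space, let η ∈ (0, diam(X)], let y₁, …, y_J (with J ≥ 2) be distinct points of X such that the closed balls of radius η centred at the yⱼ cover X, and let q ∈ (1, √(1 + 1/(J−1))). Then there exist a dense sequence (xₙ)_{n∈ℕ} in X and a map β : ℕ → {1, …, J} such that: (a) every preimage β⁻¹({j}) is infinite; (b) for every n ∈ ℕ, d(xₙ, y_{β(n)}) = min_{1 ≤ j ≤ J} d(xₙ, yⱼ); and (c) for every j ∈ {1, …, J}, ∑_{n ∈ β⁻¹({j})} q^{−2n} = (1/J) · q²/(q² − 1). -/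
/-- The remaining capacities of the greedy distribution of the weights `w n`: starting from `c`,
each weight is removed from a coordinate selected by `a`. -/
def greedyRemainder {ι : Type*} [DecidableEq ι] (a : (ι → ℝ) → ι) (w : ℕ → ℝ) (c : ι → ℝ) :
    ℕ → ι → ℝ
  | 0 => c
  | n + 1 => fun j => greedyRemainder a w c n j -
      if a (greedyRemainder a w c n) = j then w n else 0

/-- If `card ι * (1 - r) < 1`, then the geometric series of ratio `r` can be split into `card ι`
infinite subseries having the same sum. -/
theorem exists_equal_split_geometric {ι : Type*} [Fintype ι] [DecidableEq ι] [Nonempty ι] {r : ℝ}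
    (hr0 : 0 < r) (hr1 : r < 1) (hr : (Fintype.card ι : ℝ) * (1 - r) < 1) :
    ∃ β : ℕ → ι, ∀ j, (β ⁻¹' {j}).Infinite ∧
      HasSum (fun n => if β n = j then r ^ n else 0) (1 / (Fintype.card ι : ℝ) * (1 - r)⁻¹) := by
  have hmax : ∀ f : ι → ℝ, ∃ i, ∀ j, f j ≤ f i := fun f => Finite.exists_max f
  choose a ha using hmax
  have hcard : (0 : ℝ) < Fintype.card ι := by exact_mod_cast Fintype.card_pos
  have hr1' : 0 < 1 - r := sub_pos.2 hr1
  set c : ℝ := 1 / (Fintype.card ι : ℝ) * (1 - r)⁻¹ with hc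
  set R := greedyRemainder a (fun n => r ^ n) (fun _ => c) with hR
  have hsucc : ∀ n j, R (n + 1) j = R n j - if a (R n) = j then r ^ n else 0 := fun _ _ => rfl
  have hsum : ∀ n, ∑ j, R n j = r ^ n * (1 - r)⁻¹ := by
    intro n
    induction n with
    | zero =>
      change ∑ _j : ι, c = _
      simp only [Finset.sum_const, Finset.card_univ, nsmul_eq_mul, hc]
      field_simp
    | succ n ih =>
      simp only [hsucc, Finset.sum_sub_distrib, ih, Finset.sum_ite_eq, Finset.mem_univ, if_true]
      field_simp
      ring
  have hlt : ∀ n, r ^ n < R n (a (R n)) := by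
    intro n
    have h1 : r ^ n * (1 - r)⁻¹ ≤ Fintype.card ι * R n (a (R n)) := by
      rw [← hsum n]
      simpa using Finset.sum_le_card_nsmul Finset.univ (R n) _ (fun j _ => ha (R n) j)
    rw [← div_eq_mul_inv, div_le_iff₀ hr1'] at h1
    have hpow : 0 < r ^ n := pow_pos hr0 n
    by_contra! h
    nlinarith [mul_le_mul_of_nonneg_left h (mul_pos hcard hr1').le]
  have hpos : ∀ n j, 0 < R n j := by
    intro n
    induction n with
    | zero =>
      intro j
      change 0 < c
      positivity
    | succ n ih =>
      intro j
      rw [hsucc]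
      split_ifs with h
      · rw [← h]
        exact sub_pos.2 (hlt n)
      · simpa using ih j
  have hpartial : ∀ j n, ∑ m ∈ Finset.range n, (if a (R m) = j then r ^ m else 0) = c - R n j := by
    intro j n
    induction n with
    | zero => simp [hR, greedyRemainder]
    | succ n ih => rw [Finset.sum_range_succ, ih, hsucc]; ring
  have hlim : ∀ j, Filter.Tendsto (fun n => R n j) Filter.atTop (nhds 0) := by
    intro j
    have h0 : Filter.Tendsto (fun n => r ^ n * (1 - r)⁻¹) Filter.atTop (nhds 0) := by
      simpa using (tendsto_pow_atTop_nhds_zero_of_lt_one hr0.le hr1).mul_const (1 - r)⁻¹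
    refine squeeze_zero (fun n => (hpos n j).le) (fun n => ?_) h0
    rw [← hsum n]
    exact Finset.single_le_sum (fun i _ => (hpos n i).le) (Finset.mem_univ j)
  refine ⟨fun n => a (R n), fun j => ⟨fun hfin => ?_, ?_⟩⟩
  · obtain ⟨N, hN⟩ := hfin.bddAbove
    have hconst : ∀ n, N + 1 ≤ n → R n j = R (N + 1) j := by
      intro n hn
      induction n, hn using Nat.le_induction with
      | base => rfl
      | succ n hn ih =>
        have hne : a (R n) ≠ j := fun h => by
          have : n ≤ N := hN h
          omega
        rw [hsucc, if_neg hne, sub_zero, ih]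
    have hconst' : Filter.Tendsto (fun n => R n j) Filter.atTop (nhds (R (N + 1) j)) :=
      tendsto_const_nhds.congr' <| by
        filter_upwards [Filter.eventually_ge_atTop (N + 1)] with n hn using (hconst n hn).symm
    exact (hpos (N + 1) j).ne' (tendsto_nhds_unique hconst' (hlim j))
  · rw [hasSum_iff_tendsto_nat_of_nonneg (fun n => by split_ifs <;> positivity)]
    simp only [hpartial]
    simpa using (hlim j).const_sub c

/-- Given nonempty separable sets `V j` and a map `β` with infinite fibres, there is a sequence
with `n`-th term in `V (β n)` whose range is dense in the union of the `V j`. -/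
theorem exists_seq_mem_dense_iUnion {X ι : Type*} [PseudoMetricSpace X]
    [SecondCountableTopology X] (V : ι → Set X) (hV : ∀ j, (V j).Nonempty) (β : ℕ → ι)
    (hβ : ∀ j, (β ⁻¹' {j}).Infinite) :
    ∃ u : ℕ → X, (∀ n, u n ∈ V (β n)) ∧
      ∀ j, ∀ x ∈ V j, ∀ ε > 0, ∃ n, dist x (u n) < ε := by
  classical
  have : ∀ j, Nonempty (V j) := fun j => (hV j).to_subtype
  refine ⟨fun n => TopologicalSpace.denseSeq (V (β n)) (Nat.count (fun m => β m = β n) n),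
    fun n => Subtype.coe_prop _, fun j x hx ε hε => ?_⟩
  obtain ⟨k, hk⟩ := (TopologicalSpace.denseRange_denseSeq (V j)).exists_dist_lt ⟨x, hx⟩ hε
  have hinf : {m | β m = j}.Infinite := hβ j
  have hmem : β (Nat.nth (fun m => β m = j) k) = j := Nat.nth_mem_of_infinite hinf k
  refine ⟨Nat.nth (fun m => β m = j) k, ?_⟩
  have hcount := Nat.count_nth_of_infinite hinf k
  generalize Nat.nth (fun m => β m = j) k = n at hmem hcount
  subst hmem
  simpa only [hcount, Subtype.dist_eq] using hk


/-- Existence of an adapted basis: given a covering of a nonempty compact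
metric space `X` by closed balls of radius `η` centred at distinct points
`y₁, …, y_J` and `q ∈ (1, √(1 + 1/(J−1)))`, there is a dense sequence `(xₙ)`
in `X` and a map `β : ℕ → {1, …, J}` with infinite preimages such that each
`xₙ` is closest to `y_{β(n)}` and the sums `∑_{n ∈ β⁻¹({j})} q^{−2n}` are all
equal to `(1/J) · q²/(q² − 1)`. -/
theorem adapted_basis
    {X : Type*} [MetricSpace X] [CompactSpace X] [Nonempty X]
    (J : ℕ) (hJ : 2 ≤ J) (η : ℝ)
    (hη : η ∈ Set.Ioc (0 : ℝ) (Metric.diam (Set.univ : Set X)))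
    (y : Fin J → X) (hy : Function.Injective y)
    (hcover : ∀ x : X, ∃ j, dist x (y j) ≤ η)
    (q : ℝ) (hq1 : 1 < q) (hq2 : q < Real.sqrt (1 + 1 / ((J : ℝ) - 1))) :
    ∃ (x_ : ℕ → X) (β : ℕ → Fin J),
      (∀ (x : X) (ε : ℝ), 0 < ε → ∃ n, dist x (x_ n) ≤ ε) ∧
      (∀ j, (β ⁻¹' {j}).Infinite) ∧
      (∀ n, dist (x_ n) (y (β n)) = ⨅ j, dist (x_ n) (y j)) ∧
      ∀ j, ∑' n : (β ⁻¹' {j} : Set ℕ), 1 / q ^ (2 * (n : ℕ)) =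
        (1 / (J : ℝ)) * (q ^ 2 / (q ^ 2 - 1)) := by
  have hJ0 : (0 : ℝ) < (J : ℝ) - 1 := by
    have : (2 : ℝ) ≤ J := by exact_mod_cast hJ
    linarith
  have : NeZero J := ⟨by omega⟩
  have hq2' : q ^ 2 < 1 + 1 / ((J : ℝ) - 1) := (Real.lt_sqrt (by linarith)).1 hq2
  have hqsq : 1 < q ^ 2 := one_lt_pow₀ hq1 two_ne_zero
  have hr : (Fintype.card (Fin J) : ℝ) * (1 - (q ^ 2)⁻¹) < 1 := by
    rw [Fintype.card_fin]
    have h1 : q ^ 2 * ((J : ℝ) - 1) < J := by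
      have := mul_lt_mul_of_pos_right hq2' hJ0
      rwa [add_mul, one_div_mul_cancel hJ0.ne', one_mul, sub_add_cancel] at this
    have h2 : (J : ℝ) * (1 - (q ^ 2)⁻¹) = J * (q ^ 2 - 1) / q ^ 2 := by field_simp
    rw [h2, div_lt_one (by linarith)]
    linarith
  obtain ⟨β, hβ⟩ := exists_equal_split_geometric (inv_pos.2 (zero_lt_one.trans hqsq))
    (inv_lt_one_of_one_lt₀ hqsq) hr
  have hbdd : ∀ x, BddBelow (Set.range fun j => dist x (y j)) := fun x =>
    (Set.finite_range _).bddBelow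
  obtain ⟨u, hu, hdense⟩ := exists_seq_mem_dense_iUnion
    (fun j => {x | dist x (y j) = ⨅ i, dist x (y i)})
    (fun j => ⟨y j, le_antisymm (by simpa using Real.iInf_nonneg fun i => dist_nonneg)
      (ciInf_le (hbdd (y j)) j)⟩) β (fun j => (hβ j).1)
  refine ⟨u, β, fun x ε hε => ?_, fun j => (hβ j).1, hu, fun j => ?_⟩
  · obtain ⟨j, hj⟩ := exists_eq_ciInf_of_finite (f := fun j => dist x (y j))
    obtain ⟨n, hn⟩ := hdense j x hj ε hε
    exact ⟨n, hn.le⟩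
  · have hsum := (hβ j).2.tsum_eq
    rw [tsum_subtype (β ⁻¹' {j}) (fun n => 1 / q ^ (2 * n))]
    have hinv : (1 - (q ^ 2)⁻¹)⁻¹ = q ^ 2 / (q ^ 2 - 1) := by
      have : q ^ 2 - 1 ≠ 0 := by linarith
      field_simp
    rw [Fintype.card_fin, hinv] at hsum
    rw [← hsum]
    refine tsum_congr fun n => ?_
    by_cases h : β n = j <;> simp [Set.indicator, h, pow_mul]
end

section
/- Let J ≥ 2 be an integer, let q > 1, and let β : ℕ → {1, …, J} be a map such that for every j ∈ {1, …, J}, ∑_{n ∈ β⁻¹({j})} q^{−2n} = (1/J) · q²/(q² − 1). Set c_B = √(J(q² − 1))/q. Then the linear map B : ℝ^J → ℓ²(ℕ, ℝ) defined by B(u) = (c_B · u_{β(n)}/qⁿ)_{n∈ℕ} is well defined (its image consists of square-summable sequences) and is a linear isometry; in particular ⟨B(u), B(v)⟩_{ℓ²} = ⟨u, v⟩_{ℝ^J} for all u, v ∈ ℝ^J. -/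
/-- Summing a weight that depends only on the fibre: the sum splits over the fibres of `β`. -/
theorem hasSum_comp_mul_of_fintype {α ι : Type*} [Fintype ι] (β : α → ι) {g : α → ℝ}
    (hg : Summable g) (w : ι → ℝ) :
    HasSum (fun n => w (β n) * g n) (∑ j, w j * ∑' n : (β ⁻¹' {j} : Set α), g n) := by
  classical
  have h : HasSum (fun n => ∑ j, w j * (β ⁻¹' {j}).indicator g n)
      (∑ j, w j * ∑' n : (β ⁻¹' {j} : Set α), g n) := by
    refine hasSum_sum fun j _ => HasSum.mul_left _ ?_
    rw [tsum_subtype]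
    exact (hg.indicator _).hasSum
  refine h.congr_fun fun n => ?_
  simp [Set.indicator_apply]

theorem hasSum_mul_of_fibre_sums (J : ℕ) (hJ : 2 ≤ J) (q : ℝ) (hq : 1 < q) (β : ℕ → Fin J)
    (hβ : ∀ j, ∑' n : (β ⁻¹' {j} : Set ℕ), 1 / q ^ (2 * (n : ℕ)) =
      (1 / (J : ℝ)) * (q ^ 2 / (q ^ 2 - 1))) (u v : Fin J → ℝ) :
    HasSum (fun n : ℕ =>
      (Real.sqrt ((J : ℝ) * (q ^ 2 - 1)) / q * u (β n) / q ^ n) *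
      (Real.sqrt ((J : ℝ) * (q ^ 2 - 1)) / q * v (β n) / q ^ n)) (∑ j, u j * v j) := by
  have hq0 : 0 < q := by linarith
  have hJ0 : (0 : ℝ) < J := by exact_mod_cast (by omega : 0 < J)
  have hq2 : 0 < q ^ 2 - 1 := by nlinarith
  have hc : Real.sqrt ((J : ℝ) * (q ^ 2 - 1)) ^ 2 = J * (q ^ 2 - 1) :=
    Real.sq_sqrt (by positivity)
  have hg : Summable fun n : ℕ => 1 / q ^ (2 * n) := by
    have h := summable_geometric_of_lt_one (r := (q ^ 2)⁻¹) (by positivity)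
      (inv_lt_one_of_one_lt₀ (by linarith))
    simpa [pow_mul] using h
  have h := hasSum_comp_mul_of_fintype β hg fun j => J * (q ^ 2 - 1) / q ^ 2 * (u j * v j)
  convert h using 1
  · funext n
    rw [pow_mul']
    generalize Real.sqrt _ = c at hc ⊢
    rw [← hc]
    field_simp
  · refine Finset.sum_congr rfl fun j _ => ?_
    rw [hβ]
    field_simp

/-- Given `J ≥ 2`, `q > 1` and `β : ℕ → {1, …, J}` with
`∑_{n ∈ β⁻¹({j})} q^{−2n} = (1/J) · q²/(q² − 1)` for every `j`, the map
`B : ℝ^J → ℓ²(ℕ, ℝ)`, `B(u) = (c_B · u_{β(n)}/qⁿ)ₙ` with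
`c_B = √(J(q² − 1))/q`, is well defined (its values are square-summable),
linear, and a linear isometry; in particular it preserves inner products. -/
theorem B_isometry
    (J : ℕ) (hJ : 2 ≤ J) (q : ℝ) (hq : 1 < q) (β : ℕ → Fin J)
    (hβ : ∀ j, ∑' n : (β ⁻¹' {j} : Set ℕ), 1 / q ^ (2 * (n : ℕ)) =
      (1 / (J : ℝ)) * (q ^ 2 / (q ^ 2 - 1))) :
    (∀ u : EuclideanSpace ℝ (Fin J),
      Memℓp (fun n : ℕ =>
        Real.sqrt ((J : ℝ) * (q ^ 2 - 1)) / q * u (β n) / q ^ n) 2) ∧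
    ∀ B : EuclideanSpace ℝ (Fin J) → lp (fun _ : ℕ => ℝ) 2,
      (∀ (u : EuclideanSpace ℝ (Fin J)) (n : ℕ),
        B u n = Real.sqrt ((J : ℝ) * (q ^ 2 - 1)) / q * u (β n) / q ^ n) →
      IsLinearMap ℝ B ∧ Isometry B ∧
      ∀ u v : EuclideanSpace ℝ (Fin J),
        inner (𝕜 := ℝ) (B u) (B v) = inner (𝕜 := ℝ) u v := by
  have key := hasSum_mul_of_fibre_sums J hJ q hq β hβ
  refine ⟨fun u => ?_, fun B hB => ?_⟩
  · rw [memℓp_gen_iff (by norm_num)]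
    refine (key u u).summable.congr fun n => ?_
    rw [ENNReal.toReal_ofNat, Real.rpow_ofNat, Real.norm_eq_abs, sq_abs, pow_two (_ / _)]
  · have hadd : ∀ u v, B (u + v) = B u + B v := fun u v => by
      ext n
      rw [lp.coeFn_add, Pi.add_apply, hB, hB, hB, PiLp.add_apply]
      ring
    have hsmul : ∀ (a : ℝ) u, B (a • u) = a • B u := fun a u => by
      ext n
      rw [lp.coeFn_smul, Pi.smul_apply, hB, hB, PiLp.smul_apply, smul_eq_mul, smul_eq_mul]
      ring
    have hinner : ∀ u v, inner (𝕜 := ℝ) (B u) (B v) = inner (𝕜 := ℝ) u v := fun u v => by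
      rw [lp.inner_eq_tsum, PiLp.inner_apply]
      simp only [hB, RCLike.inner_apply, conj_trivial]
      exact (key v u).tsum_eq
    exact ⟨⟨hadd, hsmul⟩,
      ((IsLinearMap.mk' B ⟨hadd, hsmul⟩).isometryOfInner hinner).isometry, hinner⟩
end

section
/- Let (X, d) be a nonempty compact metric space with diameter D_X, let η ∈ (0, D_X], let y₁, …, y_J (J ≥ 2) be distinct points of X whose closed balls of radius η cover X, let q ∈ (1, √(1 + 1/(J−1))), and let (xₙ)_{n∈ℕ} be a dense sequence in X together with β : ℕ → {1, …, J} such that d(xₙ, y_{β(n)}) = min_j d(xₙ, yⱼ) for all n and ∑_{n ∈ β⁻¹({j})} q^{−2n} = (1/J)·q²/(q²−1) for each j. Define φ : X → ℓ² by φ(x) = ((√(q²−1)/q) · d(x, xₙ)/qⁿ)ₙ, φ̂ : X → ℝ^J by φ̂(x) = (d(x, yⱼ)/√J)ⱼ, and B : ℝ^J → ℓ² by B(u) = ((√(J(q²−1))/q) · u_{β(n)}/qⁿ)ₙ. Then for every x ∈ X, ‖φ(x) − B(φ̂(x))‖_{ℓ²} ≤ η; moreover the set W = φ(X) ∪ B(φ̂(X))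 has diameter at most 2·D_X. -/
/-- The weights `(√(q² - 1) / q) / qⁿ` form a unit vector of `ℓ²`. -/
theorem hasSum_sq_weight {q : ℝ} (hq : 1 < q) :
    HasSum (fun n : ℕ => (Real.sqrt (q ^ 2 - 1) / q / q ^ n) ^ 2) 1 := by
  have hq0 : 0 < q := by linarith
  have hq2 : 0 < q ^ 2 - 1 := by nlinarith
  have h1 : (q ^ 2)⁻¹ < 1 := inv_lt_one_of_one_lt₀ (by linarith)
  have h := (hasSum_geometric_of_lt_one (by positivity) h1).mul_left ((q ^ 2 - 1) / q ^ 2)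
  have hsum : (q ^ 2 - 1) / q ^ 2 * (1 - (q ^ 2)⁻¹)⁻¹ = 1 := by
    have : 1 - (q ^ 2)⁻¹ = (q ^ 2 - 1) / q ^ 2 := by field_simp
    rw [this, mul_inv_cancel₀ (by positivity)]
  rw [hsum] at h
  refine (congrArg (HasSum · 1) (funext fun n => ?_)).mpr h
  rw [div_pow, div_pow, Real.sq_sqrt hq2.le, inv_pow, ← pow_mul, ← pow_mul, mul_comm n 2]
  rfl

/-- A vector of `ℓ²` dominated by `M` times the geometric weights has norm at most `M`. -/
theorem norm_le_of_abs_le_weight {q M : ℝ} (hq : 1 < q) (hM : 0 ≤ M)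
    (w : lp (fun _ : ℕ => ℝ) 2)
    (hw : ∀ n, |w n| ≤ Real.sqrt (q ^ 2 - 1) / q / q ^ n * M) : ‖w‖ ≤ M := by
  refine lp.norm_le_of_forall_sum_le (by norm_num) hM fun s => ?_
  have h := (hasSum_sq_weight hq).mul_right (M ^ 2)
  simp only [ENNReal.toReal_ofNat, Real.rpow_ofNat, Real.norm_eq_abs]
  calc ∑ n ∈ s, |w n| ^ 2
      ≤ ∑ n ∈ s, (Real.sqrt (q ^ 2 - 1) / q / q ^ n) ^ 2 * M ^ 2 := by
        refine Finset.sum_le_sum fun n _ => ?_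
        rw [← mul_pow]
        exact pow_le_pow_left₀ (abs_nonneg _) (hw n) 2
    _ ≤ 1 * M ^ 2 := sum_le_hasSum s (fun _ _ => by positivity) h
    _ = M ^ 2 := one_mul _


/-- Approximation of the embedding `φ` by the finite-dimensional surrogate
`B ∘ φ̂` in `ℓ²`: for every `x`, `‖φ(x) − B(φ̂(x))‖ ≤ η`, and the set
`W = φ(X) ∪ B(φ̂(X))` has diameter at most `2 · diam(X)`. -/
theorem approx_l2
    {X : Type*} [MetricSpace X] [CompactSpace X] [Nonempty X]
    (J : ℕ) (hJ : 2 ≤ J) (η : ℝ)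
    (hη : η ∈ Set.Ioc (0 : ℝ) (Metric.diam (Set.univ : Set X)))
    (y : Fin J → X) (hy : Function.Injective y)
    (hcover : ∀ x : X, ∃ j, dist x (y j) ≤ η)
    (q : ℝ) (hq1 : 1 < q) (hq2 : q < Real.sqrt (1 + 1 / ((J : ℝ) - 1)))
    (x_ : ℕ → X) (hdense : ∀ (x : X) (ε : ℝ), 0 < ε → ∃ n, dist x (x_ n) ≤ ε)
    (β : ℕ → Fin J)
    (hβmin : ∀ (n : ℕ) (j : Fin J), dist (x_ n) (y (β n)) ≤ dist (x_ n) (y j))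
    (hβ : ∀ j, ∑' n : (β ⁻¹' {j} : Set ℕ), 1 / q ^ (2 * (n : ℕ)) =
      (1 / (J : ℝ)) * (q ^ 2 / (q ^ 2 - 1)))
    (φ : X → lp (fun _ : ℕ => ℝ) 2)
    (hφ : ∀ (x : X) (n : ℕ),
      φ x n = Real.sqrt (q ^ 2 - 1) / q * dist x (x_ n) / q ^ n)
    (φhat : X → EuclideanSpace ℝ (Fin J))
    (hφhat : ∀ (x : X) (j : Fin J), φhat x j = dist x (y j) / Real.sqrt J)
    (B : EuclideanSpace ℝ (Fin J) → lp (fun _ : ℕ => ℝ) 2)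
    (hB : ∀ (u : EuclideanSpace ℝ (Fin J)) (n : ℕ),
      B u n = Real.sqrt ((J : ℝ) * (q ^ 2 - 1)) / q * u (β n) / q ^ n) :
    (∀ x : X, ‖φ x - B (φhat x)‖ ≤ η) ∧
    Metric.diam (Set.range φ ∪ Set.range (fun x => B (φhat x))) ≤
      2 * Metric.diam (Set.univ : Set X) := by
  have hq0 : 0 < q := by linarith
  have hJ0 : (0 : ℝ) < J := by exact_mod_cast (by omega : 0 < J)
  have hc : ∀ n : ℕ, 0 ≤ Real.sqrt (q ^ 2 - 1) / q / q ^ n := fun n => by positivity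
  have hφ' : ∀ x n, φ x n = Real.sqrt (q ^ 2 - 1) / q / q ^ n * dist x (x_ n) := fun x n => by
    rw [hφ]; ring
  have hB' : ∀ x n, B (φhat x) n =
      Real.sqrt (q ^ 2 - 1) / q / q ^ n * dist x (y (β n)) := fun x n => by
    rw [hB, hφhat, Real.sqrt_mul hJ0.le]
    have : Real.sqrt J ≠ 0 := (Real.sqrt_pos.2 hJ0).ne'
    field_simp
  refine ⟨fun x => norm_le_of_abs_le_weight hq1 hη.1.le _ fun n => ?_, ?_⟩
  · obtain ⟨j, hj⟩ := hcover (x_ n)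
    rw [lp.coeFn_sub, Pi.sub_apply, hφ', hB', ← mul_sub, abs_mul, abs_of_nonneg (hc n)]
    refine mul_le_mul_of_nonneg_left ?_ (hc n)
    rw [dist_comm x, dist_comm x]
    exact (abs_dist_sub_le _ _ _).trans ((hβmin n j).trans hj)
  · have hD : 0 ≤ Metric.diam (Set.univ : Set X) := Metric.diam_nonneg
    have hdist : ∀ a b : X, dist a b ≤ Metric.diam (Set.univ : Set X) := fun a b =>
      Metric.dist_le_diam_of_mem isCompact_univ.isBounded (Set.mem_univ a) (Set.mem_univ b)
    have hW : ∀ w ∈ Set.range φ ∪ Set.range (fun x => B (φhat x)), ∀ n,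
        w n ∈ Set.Icc 0 (Real.sqrt (q ^ 2 - 1) / q / q ^ n *
          Metric.diam (Set.univ : Set X)) := by
      rintro w (⟨x, rfl⟩ | ⟨x, rfl⟩) n
      · rw [hφ']
        exact ⟨mul_nonneg (hc n) dist_nonneg, mul_le_mul_of_nonneg_left (hdist _ _) (hc n)⟩
      · rw [hB']
        exact ⟨mul_nonneg (hc n) dist_nonneg, mul_le_mul_of_nonneg_left (hdist _ _) (hc n)⟩
    refine Metric.diam_le_of_forall_dist_le (by positivity) fun u hu v hv => ?_
    rw [dist_eq_norm]
    refine (norm_le_of_abs_le_weight hq1 hD _ fun n => ?_).trans (by linarith)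
    simpa [lp.coeFn_sub] using abs_sub_le_of_nonneg_of_le (hW u hu n).1 (hW u hu n).2
      (hW v hv n).1 (hW v hv n).2
end

section
/- Let D > 0, let W be a nonempty subset of the closed ball of radius D centred at 0 in ℓ²(ℕ, ℝ), let (aₙ) be positive reals such that K(t) = ∑ₙ aₙ tⁿ converges absolutely for all |t| ≤ 4D², and let C = max_{t ∈ [−4D², 4D²]} |K'(t)|. Then for all u, v ∈ W, K(⟨u,u⟩) − 2·K(⟨u,v⟩) + K(⟨v,v⟩) ≤ 2·D·C·‖u − v‖_{ℓ²}. (Equivalently, the canonical feature map of the Taylor kernel k_W(u,v) = K(⟨u,v⟩_{ℓ²}) is ½-Hölder with constant √(2DC): ‖Φ_W(u) − Φ_W(v)‖² = k_W(u,u) − 2k_W(u,v) + k_W(v,v) ≤ 2DC‖u−v‖_{ℓ²}.) -/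
/-- A real power series that converges absolutely at `r` is differentiable on `(-r, r)`. -/
theorem differentiableAt_tsum_mul_pow {a : ℕ → ℝ} {r t : ℝ} (hr : 0 ≤ r)
    (h : Summable fun n : ℕ => |a n * r ^ n|) (ht : |t| < r) :
    DifferentiableAt ℝ (fun x : ℝ => ∑' n : ℕ, a n * x ^ n) t := by
  set p := FormalMultilinearSeries.ofScalars ℝ a
  lift r to NNReal using hr
  have hrad : (r : ENNReal) ≤ p.radius := by
    refine p.le_radius_of_summable_norm ?_
    refine h.congr fun n => ?_
    simp [p, abs_mul]
  have hpos : 0 < p.radius := by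
    refine lt_of_lt_of_le ?_ hrad
    exact_mod_cast (abs_nonneg t).trans_lt ht
  have hsum : (fun x : ℝ => ∑' n : ℕ, a n * x ^ n) = p.sum := by
    funext x
    simp [p, FormalMultilinearSeries.sum, mul_comm]
  rw [hsum]
  refine ((p.hasFPowerSeriesOnBall hpos).analyticAt_of_mem ?_).differentiableAt
  refine Metric.eball_subset_eball hrad ?_
  rw [Metric.eball_coe]
  simpa using ht

/-- Hölder regularity of the canonical feature map of a Taylor kernel: for a
subset `W` of the closed ball of radius `D` in `ℓ²`, a Taylor function
`K(t) = ∑ₙ aₙ tⁿ` (absolutely convergent for `|t| ≤ 4D²`) and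
`C = max_{|t| ≤ 4D²} |K'(t)|`, one has
`K⟨u,u⟩ − 2K⟨u,v⟩ + K⟨v,v⟩ ≤ 2·D·C·‖u − v‖` for all `u, v ∈ W`. -/
theorem taylor_feature_map_holder
    (D : ℝ) (hD : 0 < D)
    (W : Set (lp (fun _ : ℕ => ℝ) 2)) (hWne : W.Nonempty)
    (hW : W ⊆ Metric.closedBall 0 D)
    (a : ℕ → ℝ) (ha : ∀ n, 0 < a n)
    (hconv : ∀ t : ℝ, |t| ≤ 4 * D ^ 2 → Summable fun n : ℕ => |a n * t ^ n|)
    (K : ℝ → ℝ) (hK : ∀ t : ℝ, K t = ∑' n : ℕ, a n * t ^ n)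
    (C : ℝ)
    (hC : IsGreatest ((fun t => |deriv K t|) ''
      Set.Icc (-(4 * D ^ 2)) (4 * D ^ 2)) C) :
    ∀ u ∈ W, ∀ v ∈ W,
      K (inner (𝕜 := ℝ) u u) - 2 * K (inner (𝕜 := ℝ) u v) +
          K (inner (𝕜 := ℝ) v v) ≤
        2 * D * C * ‖u - v‖ := by
  intro u hu v hv
  have hu' : ‖u‖ ≤ D := by simpa using hW hu
  have hv' : ‖v‖ ≤ D := by simpa using hW hv
  have hD2 : 0 < D ^ 2 := by positivity
  have hKfun : K = fun t => ∑' n : ℕ, a n * t ^ n := funext hK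
  have hdiff : ∀ t ∈ Set.Icc (-(D ^ 2)) (D ^ 2), DifferentiableAt ℝ K t := fun t ht => by
    rw [hKfun]
    refine differentiableAt_tsum_mul_pow (r := 4 * D ^ 2) (by positivity)
      (hconv _ (abs_of_pos (by positivity)).le) ?_
    linarith [abs_le.mpr ht]
  have hderiv : ∀ t ∈ Set.Icc (-(D ^ 2)) (D ^ 2), ‖deriv K t‖ ≤ C := fun t ht =>
    hC.2 ⟨t, ⟨by linarith [ht.1], by linarith [ht.2]⟩, rfl⟩
  have hC0 : 0 ≤ C := (norm_nonneg _).trans (hderiv 0 ⟨by linarith, hD2.le⟩)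
  have hmem : ∀ x y : lp (fun _ : ℕ => ℝ) 2, ‖x‖ ≤ D → ‖y‖ ≤ D →
      inner ℝ x y ∈ Set.Icc (-(D ^ 2)) (D ^ 2) := fun x y hx hy =>
    abs_le.mp <| (abs_real_inner_le_norm x y).trans <| by
      rw [sq]
      gcongr
  have key : ∀ x y : lp (fun _ : ℕ => ℝ) 2, ‖x‖ ≤ D → ‖y‖ ≤ D →
      K (inner ℝ x x) - K (inner ℝ x y) ≤ C * (D * ‖x - y‖) := fun x y hx hy => by
    have hmvt := (convex_Icc (-(D ^ 2)) (D ^ 2)).norm_image_sub_le_of_norm_deriv_le hdiff hderiv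
      (hmem x y hx hy) (hmem x x hx hx)
    rw [← inner_sub_right] at hmvt
    refine (le_abs_self _).trans (hmvt.trans ?_)
    gcongr
    exact (norm_inner_le_norm x (x - y)).trans (by gcongr)
  have h₁ := key u v hu' hv'
  have h₂ := key v u hv' hu'
  rw [norm_sub_rev, real_inner_comm u v] at h₂
  linarith
end

section
/- Let (X, d) be a nonempty compact metric space with diameter D_X > 0, let η ∈ (0, D_X], let y₁, …, y_J (J ≥ 2) be distinct points of X whose closed balls of radius η cover X, let q ∈ (1, √(1 + 1/(J−1))), and let (xₙ) be a dense sequence in X together with β : ℕ → {1, …, J} such that d(xₙ, y_{β(n)}) = min_j d(xₙ, yⱼ) for all n and ∑_{n ∈ β⁻¹({j})} q^{−2n} = (1/J)·q²/(q²−1) for each j. Define φ(x) = ((√(q²−1)/q)·d(x, xₙ)/qⁿ)ₙ ∈ ℓ², φ̂(x) = (d(x, yⱼ)/√J)ⱼ ∈ ℝ^J, and B(u) = ((√(J(q²−1))/q)·u_{β(n)}/qⁿ)ₙ ∈ ℓ². Let μ be a finite Borel measure on [0, ∞), K(t) = ∫₀^∞ e^{−st} dμ(s), and C = max_{t ∈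 [0, 4D_X²]} |K'(t)|. Then for every m ∈ ℕ, all z₁, …, z_m ∈ X and all reals a₁, …, a_m: sup_{x ∈ X} |∑_{i=1}^m aᵢ (K(‖φ(zᵢ) − φ(x)‖²_{ℓ²}) − K(‖φ(zᵢ) − B(φ̂(x))‖²_{ℓ²}))| ≤ η·√(2C) · √(∑_{i,j} aᵢ aⱼ K(‖φ(zᵢ) − φ(zⱼ)‖²_{ℓ²})). -/
open MeasureTheory ProbabilityTheory Set

section PositiveDefiniteness

variable {ι E : Type*} [Fintype ι] [NormedAddCommGroup E] [InnerProductSpace ℝ E]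

theorem sum_mul_inner_pow_nonneg (u : ι → E) (n : ℕ) (c : ι → ℝ) :
    0 ≤ ∑ i, ∑ j, c i * c j * inner ℝ (u i) (u j) ^ n := by
  have hpsd : (Matrix.of fun i j => inner ℝ (u i) (u j) ^ n).PosSemidef := by
    induction n with
    | zero =>
      convert Matrix.posSemidef_vecMulVec_self_star (fun _ : ι => (1 : ℝ)) using 1
      ext i j
      simp [Matrix.vecMulVec]
    | succ n ih =>
      have h : (Matrix.of fun i j => inner ℝ (u i) (u j) ^ (n + 1)) =
          (Matrix.of fun i j => inner ℝ (u i) (u j) ^ n).hadamard (Matrix.gram ℝ u) := by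
        ext i j
        simp [Matrix.gram, pow_succ]
      rw [h]
      exact ih.hadamard (Matrix.posSemidef_gram ℝ u)
  have h := hpsd.dotProduct_mulVec_nonneg c
  simp only [dotProduct, Matrix.mulVec, Finset.mul_sum, Matrix.of_apply, star_trivial] at h
  refine h.trans_eq (Finset.sum_congr rfl fun i _ => Finset.sum_congr rfl fun j _ => ?_)
  ring

theorem sum_mul_exp_inner_nonneg (u : ι → E) {s : ℝ} (hs : 0 ≤ s) (c : ι → ℝ) :
    0 ≤ ∑ i, ∑ j, c i * c j * Real.exp (s * inner ℝ (u i) (u j)) := by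
  have hsum : HasSum
      (fun n : ℕ => ∑ i, ∑ j, c i * c j * ((s * inner ℝ (u i) (u j)) ^ n / n.factorial))
      (∑ i, ∑ j, c i * c j * Real.exp (s * inner ℝ (u i) (u j))) := by
    refine hasSum_sum fun i _ => hasSum_sum fun j _ => HasSum.mul_left _ ?_
    rw [Real.exp_eq_exp_ℝ]
    exact NormedSpace.expSeries_div_hasSum_exp _
  refine hsum.nonneg fun n => ?_
  have h : ∑ i, ∑ j, c i * c j * ((s * inner ℝ (u i) (u j)) ^ n / n.factorial) =
      s ^ n / n.factorial * ∑ i, ∑ j, c i * c j * inner ℝ (u i) (u j) ^ n := by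
    simp only [Finset.mul_sum]
    refine Finset.sum_congr rfl fun i _ => Finset.sum_congr rfl fun j _ => ?_
    rw [mul_pow]
    ring
  rw [h]
  exact mul_nonneg (by positivity) (sum_mul_inner_pow_nonneg u n c)

/-- The Gaussian kernel on a real inner product space is positive semidefinite. -/
theorem sum_mul_gaussian_nonneg (u : ι → E) {s : ℝ} (hs : 0 ≤ s) (c : ι → ℝ) :
    0 ≤ ∑ i, ∑ j, c i * c j * Real.exp (-(s * ‖u i - u j‖ ^ 2)) := by
  have h := sum_mul_exp_inner_nonneg u (mul_nonneg zero_le_two hs)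
    fun i => c i * Real.exp (-(s * ‖u i‖ ^ 2))
  refine h.trans_eq (Finset.sum_congr rfl fun i _ => Finset.sum_congr rfl fun j _ => ?_)
  have he : Real.exp (-(s * ‖u i - u j‖ ^ 2)) = Real.exp (-(s * ‖u i‖ ^ 2)) *
      Real.exp (-(s * ‖u j‖ ^ 2)) * Real.exp (2 * s * inner ℝ (u i) (u j)) := by
    rw [← Real.exp_add, ← Real.exp_add, norm_sub_sq_real]
    ring_nf
  rw [he]
  ring

/-- The Cauchy–Schwarz inequality in the reproducing kernel space of a symmetric positive
semidefinite kernel `k`, applied to the functionals `∑ i, c i * k (u i) ·` and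
`k p · - k w ·`. -/
theorem sq_sum_mul_kernel_sub_le {S : Type*} (k : S → S → ℝ) (hsymm : ∀ a b, k a b = k b a)
    (hpsd : ∀ (n : ℕ) (u : Fin n → S) (c : Fin n → ℝ), 0 ≤ ∑ i, ∑ j, c i * c j * k (u i) (u j))
    {m : ℕ} (u : Fin m → S) (c : Fin m → ℝ) (p w : S) :
    (∑ i, c i * (k (u i) p - k (u i) w)) ^ 2 ≤
      (∑ i, ∑ j, c i * c j * k (u i) (u j)) * (k p p + k w w - 2 * k p w) := by
  have hquad (t : ℝ) : 0 ≤ (k p p + k w w - 2 * k p w) * (t * t) +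
      (2 * ∑ i, c i * (k (u i) p - k (u i) w)) * t + ∑ i, ∑ j, c i * c j * k (u i) (u j) := by
    have h := hpsd (m + 2) (Fin.cons p (Fin.cons w u)) (Fin.cons t (Fin.cons (-t) c))
    simp only [Fin.sum_univ_succ, Fin.cons_zero, Fin.cons_succ] at h
    refine h.trans_eq ?_
    have hp (a : S) (r : ℝ) : ∑ i, r * c i * k a (u i) = r * ∑ i, c i * k (u i) a := by
      simp only [Finset.mul_sum, mul_assoc, hsymm a]
    have hp' (a : S) (r : ℝ) : ∑ i, c i * r * k (u i) a = r * ∑ i, c i * k (u i) a := by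
      rw [Finset.mul_sum]
      exact Finset.sum_congr rfl fun i _ => by ring
    simp only [Finset.sum_add_distrib, mul_sub, Finset.sum_sub_distrib, hp, hp', hsymm w p]
    ring
  have h := discrim_le_zero hquad
  rw [discrim] at h
  linarith

end PositiveDefiniteness

section LaplaceTransform

variable {μ : Measure ℝ} [IsFiniteMeasure μ]

theorem exp_neg_mul_le_one_of_mem_Ici {t s : ℝ} (ht : 0 ≤ t) (hs : s ∈ Ici (0 : ℝ)) :
    ‖Real.exp (-(s * t))‖ ≤ 1 := by
  rw [Real.norm_eq_abs, Real.abs_exp, Real.exp_le_one_iff, neg_nonpos]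
  exact mul_nonneg hs ht

theorem integrableOn_exp_neg_mul {t : ℝ} (ht : 0 ≤ t) :
    IntegrableOn (fun s => Real.exp (-(s * t))) (Ici 0) μ :=
  Integrable.of_bound (C := 1) (by fun_prop) <|
    (ae_restrict_mem measurableSet_Ici).mono fun _ hs => exp_neg_mul_le_one_of_mem_Ici ht hs

theorem continuousOn_laplace :
    ContinuousOn (fun t => ∫ s in Ici (0 : ℝ), Real.exp (-(s * t)) ∂μ) (Ici 0) :=
  continuousOn_of_dominated (bound := fun _ => 1) (fun _ _ => by fun_prop)
    (fun _ ht => (ae_restrict_mem measurableSet_Ici).mono fun _ hs =>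
      exp_neg_mul_le_one_of_mem_Ici ht hs)
    (integrable_const _) (.of_forall fun _ => by fun_prop)

theorem differentiableAt_laplace {t : ℝ} (ht : 0 < t) :
    DifferentiableAt ℝ (fun t => ∫ s in Ici (0 : ℝ), Real.exp (-(s * t)) ∂μ) t := by
  have hsub : Iic (0 : ℝ) ⊆ integrableExpSet id (μ.restrict (Ici 0)) := fun r hr => by
    have h := integrableOn_exp_neg_mul (μ := μ) (neg_nonneg.2 hr)
    simpa [integrableExpSet, IntegrableOn, mul_comm] using h
  have hint : -t ∈ interior (integrableExpSet id (μ.restrict (Ici 0))) :=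
    interior_mono hsub (by simpa using ht)
  have h := (differentiableAt_mgf hint).comp t differentiableAt_id.neg
  refine h.congr_of_eventuallyEq (.of_forall fun r => ?_)
  simp [mgf, mul_comm]

theorem sum_mul_laplace_nonneg {ι E : Type*} [Fintype ι] [NormedAddCommGroup E]
    [InnerProductSpace ℝ E] (u : ι → E) (c : ι → ℝ) :
    0 ≤ ∑ i, ∑ j, c i * c j * ∫ s in Ici (0 : ℝ), Real.exp (-(s * ‖u i - u j‖ ^ 2)) ∂μ := by
  have hint (i j : ι) :
      IntegrableOn (fun s => c i * c j * Real.exp (-(s * ‖u i - u j‖ ^ 2))) (Ici 0) μ :=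
    (integrableOn_exp_neg_mul (sq_nonneg _)).const_mul _
  have h : 0 ≤ ∫ s in Ici (0 : ℝ),
      ∑ i, ∑ j, c i * c j * Real.exp (-(s * ‖u i - u j‖ ^ 2)) ∂μ :=
    setIntegral_nonneg measurableSet_Ici fun s hs => sum_mul_gaussian_nonneg u hs c
  rw [integral_finsetSum _ fun i _ => integrable_finsetSum _ fun j _ => hint i j] at h
  refine h.trans_eq (Finset.sum_congr rfl fun i _ => ?_)
  rw [integral_finsetSum _ fun j _ => hint i j]
  exact Finset.sum_congr rfl fun j _ => integral_const_mul _ _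

end LaplaceTransform

/-- A bound on the derivative over `(0, r)` bounds the decrease over `[0, r]`. -/
theorem sub_le_mul_of_abs_deriv_le {f : ℝ → ℝ} {C r : ℝ} (hr : 0 ≤ r)
    (hcont : ContinuousOn f (Icc 0 r)) (hdiff : DifferentiableOn ℝ f (Ioo 0 r))
    (hC : ∀ t ∈ Ioo 0 r, |deriv f t| ≤ C) : f 0 - f r ≤ C * r := by
  rcases hr.eq_or_lt with rfl | hr
  · simp
  obtain ⟨t, ht, h⟩ := exists_deriv_eq_slope f hr hcont hdiff
  rw [sub_zero, eq_div_iff hr.ne'] at h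
  nlinarith [neg_le_of_abs_le (hC t ht)]

/-- The weights `(q² - 1) / q² · q⁻²ⁿ` form a probability distribution on `ℕ`. -/
theorem hasSum_geometric_weight {q : ℝ} (hq : 1 < q) :
    HasSum (fun n : ℕ => (q ^ 2 - 1) / q ^ 2 / q ^ (2 * n)) 1 := by
  have hlt : (q ^ 2)⁻¹ < 1 := inv_lt_one_of_one_lt₀ (one_lt_pow₀ hq two_ne_zero)
  have h := (hasSum_geometric_of_lt_one (by positivity) hlt).mul_left ((q ^ 2 - 1) / q ^ 2)
  have h1 : q ^ 2 - 1 ≠ 0 := by nlinarith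
  have h2 : q ^ 2 ≠ 0 := by positivity
  have hone : (q ^ 2 - 1) / q ^ 2 * (1 - (q ^ 2)⁻¹)⁻¹ = 1 := by
    rw [show 1 - (q ^ 2)⁻¹ = (q ^ 2 - 1) / q ^ 2 by field_simp]
    exact mul_inv_cancel₀ (div_ne_zero h1 h2)
  simpa only [hone, inv_pow, ← pow_mul, ← div_eq_mul_inv] using h

/-- An element of `ℓ²` whose coordinates are bounded by `ε` times the square roots of the
geometric weights has norm at most `ε`. -/
theorem lp_norm_sq_le_of_sq_le_geometric {q ε : ℝ} (hq : 1 < q)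
    (f : lp (fun _ : ℕ => ℝ) 2)
    (hf : ∀ n, f n ^ 2 ≤ ε ^ 2 * ((q ^ 2 - 1) / q ^ 2 / q ^ (2 * n))) : ‖f‖ ^ 2 ≤ ε ^ 2 := by
  have hnorm := lp.hasSum_norm (p := 2) (by norm_num) f
  simp only [ENNReal.toReal_ofNat, Real.rpow_two, Real.norm_eq_abs, sq_abs] at hnorm
  have h := hasSum_le hf hnorm ((hasSum_geometric_weight hq).mul_left (ε ^ 2))
  rwa [mul_one] at h


/-- Approximation of the universal radial kernel `k(x,y) = K(‖φ x − φ y‖²)` by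
the tractable kernel `K(‖φ x − B(φ̂ y)‖²)`: the uniform error over `x ∈ X` of
any finite kernel expansion `∑ᵢ aᵢ k(zᵢ, ·)` is bounded by
`η·√(2C) · √(∑_{i,j} aᵢ aⱼ k(zᵢ, zⱼ))`. -/
theorem radial_approx_universal
    {X : Type*} [MetricSpace X] [CompactSpace X] [Nonempty X]
    (hD : 0 < Metric.diam (Set.univ : Set X))
    (J : ℕ) (hJ : 2 ≤ J) (η : ℝ)
    (hη : η ∈ Set.Ioc (0 : ℝ) (Metric.diam (Set.univ : Set X)))
    (y : Fin J → X) (hy : Function.Injective y)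
    (hcover : ∀ x : X, ∃ j, dist x (y j) ≤ η)
    (q : ℝ) (hq1 : 1 < q) (hq2 : q < Real.sqrt (1 + 1 / ((J : ℝ) - 1)))
    (x_ : ℕ → X) (hdense : ∀ (x : X) (ε : ℝ), 0 < ε → ∃ n, dist x (x_ n) ≤ ε)
    (β : ℕ → Fin J)
    (hβmin : ∀ (n : ℕ) (j : Fin J), dist (x_ n) (y (β n)) ≤ dist (x_ n) (y j))
    (hβ : ∀ j, ∑' n : (β ⁻¹' {j} : Set ℕ), 1 / q ^ (2 * (n : ℕ)) =
      (1 / (J : ℝ)) * (q ^ 2 / (q ^ 2 - 1)))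
    (φ : X → lp (fun _ : ℕ => ℝ) 2)
    (hφ : ∀ (x : X) (n : ℕ),
      φ x n = Real.sqrt (q ^ 2 - 1) / q * dist x (x_ n) / q ^ n)
    (φhat : X → EuclideanSpace ℝ (Fin J))
    (hφhat : ∀ (x : X) (j : Fin J), φhat x j = dist x (y j) / Real.sqrt J)
    (B : EuclideanSpace ℝ (Fin J) → lp (fun _ : ℕ => ℝ) 2)
    (hB : ∀ (u : EuclideanSpace ℝ (Fin J)) (n : ℕ),
      B u n = Real.sqrt ((J : ℝ) * (q ^ 2 - 1)) / q * u (β n) / q ^ n)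
    (μ : MeasureTheory.Measure ℝ) [MeasureTheory.IsFiniteMeasure μ]
    (K : ℝ → ℝ)
    (hK : ∀ t : ℝ, K t = ∫ s in Set.Ici (0 : ℝ), Real.exp (-(s * t)) ∂μ)
    (C : ℝ)
    (hC : IsGreatest ((fun t => |deriv K t|) ''
      Set.Icc 0 (4 * Metric.diam (Set.univ : Set X) ^ 2)) C) :
    ∀ (m : ℕ) (z : Fin m → X) (c : Fin m → ℝ) (x : X),
      |∑ i, c i * (K (‖φ (z i) - φ x‖ ^ 2) -
          K (‖φ (z i) - B (φhat x)‖ ^ 2))| ≤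
        η * Real.sqrt (2 * C) *
          Real.sqrt (∑ i, ∑ j, c i * c j * K (‖φ (z i) - φ (z j)‖ ^ 2)) := by
  intro m z c x
  have hJpos : (0 : ℝ) < J := by positivity
  have hq2pos : 0 ≤ q ^ 2 - 1 := by nlinarith
  have hcoord (n : ℕ) : (φ x - B (φhat x)) n =
      Real.sqrt (q ^ 2 - 1) / q / q ^ n * (dist x (x_ n) - dist x (y (β n))) := by
    have hs : Real.sqrt J ≠ 0 := (Real.sqrt_pos.2 hJpos).ne'
    rw [lp.coeFn_sub, Pi.sub_apply, hφ, hB, hφhat, Real.sqrt_mul hJpos.le]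
    field_simp
  have hnear (n : ℕ) : |dist x (x_ n) - dist x (y (β n))| ≤ η := by
    obtain ⟨j, hj⟩ := hcover (x_ n)
    rw [dist_comm x, dist_comm x]
    exact (abs_dist_sub_le _ _ _).trans ((hβmin n j).trans hj)
  have hle : ‖φ x - B (φhat x)‖ ^ 2 ≤ η ^ 2 := by
    refine lp_norm_sq_le_of_sq_le_geometric hq1 _ fun n => ?_
    rw [hcoord, mul_pow, div_pow, div_pow, Real.sq_sqrt hq2pos, ← pow_mul, mul_comm n,
      mul_comm (η ^ 2)]
    have hdist := sq_le_sq' (neg_le_of_abs_le (hnear n)) (le_of_abs_le (hnear n))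
    gcongr
  have hKeq : K = fun t => ∫ s in Ici (0 : ℝ), Real.exp (-(s * t)) ∂μ := funext hK
  have hrange : η ^ 2 ≤ 4 * Metric.diam (univ : Set X) ^ 2 := by nlinarith [hη.1, hη.2]
  have hderiv {t : ℝ} (ht : t ∈ Icc 0 (4 * Metric.diam (univ : Set X) ^ 2)) :
      |deriv K t| ≤ C := hC.2 ⟨t, ht, rfl⟩
  have hC0 : 0 ≤ C := (abs_nonneg _).trans (hderiv (left_mem_Icc.2 (by positivity)))
  have hdecr : K 0 - K (‖φ x - B (φhat x)‖ ^ 2) ≤ C * η ^ 2 := by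
    refine (sub_le_mul_of_abs_deriv_le (sq_nonneg _) ?_ ?_ fun t ht =>
      hderiv ⟨ht.1.le, ht.2.le.trans (hle.trans hrange)⟩).trans (by gcongr)
    · rw [hKeq]
      exact continuousOn_laplace.mono Icc_subset_Ici_self
    · rw [hKeq]
      exact fun t ht => (differentiableAt_laplace ht.1).differentiableWithinAt
  have hpsd (n : ℕ) (u : Fin n → lp (fun _ : ℕ => ℝ) 2) (a : Fin n → ℝ) :
      0 ≤ ∑ i, ∑ j, a i * a j * K (‖u i - u j‖ ^ 2) := by
    rw [hKeq]
    exact sum_mul_laplace_nonneg u a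
  have hCS := sq_sum_mul_kernel_sub_le (fun a b => K (‖a - b‖ ^ 2))
    (fun a b => by simp only [norm_sub_rev]) hpsd (fun i => φ (z i)) c (φ x) (B (φhat x))
  refine Real.abs_le_sqrt hCS |>.trans ?_
  rw [Real.sqrt_mul (hpsd m (fun i => φ (z i)) c), mul_comm]
  refine mul_le_mul_of_nonneg_right ?_ (Real.sqrt_nonneg _)
  rw [Real.sqrt_le_left (mul_nonneg hη.1.le (Real.sqrt_nonneg _)), mul_pow,
    Real.sq_sqrt (by positivity)]
  simp only [sub_self, norm_zero, ne_eq, OfNat.ofNat_ne_zero, not_false_eq_true, zero_pow]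
  linarith
end
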